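/- There exists a finite T₀ topological space with exactly 16 points that is a unique path space but is not an EBP space; that is, it is a unique path space containing an elementary boundary pair (U, C) that is not of the form (õ{x}, closure {y}) for any points x, y with x covering y. -/

import Mathlib

open Set Topology

variable {X : Type*} [TopologicalSpace X]

/-- Specialization order: `x ≤ y` iff `x ∈ closure {y}`. -/
def SpecLE (x y : X) : Prop := x ∈ closure ({y} : Set X)

/-- Strict specialization order. -/
def SpecLT (x y : X) : Prop := SpecLE x y ∧ ¬ SpecLE y x

/-- `CoversRel y x` means `y → x`: `x < y` and there is no `z` with `x < z < y`. -/
def CoversRel (y x : X) : Prop := SpecLT x y ∧ ∀ z : X, ¬ (SpecLT x z ∧ SpecLT z y)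

/-- `IsPathList y x l`: the list `l = [z₁, …, zₙ]` is a path from `y` to `x`, i.e.
`z₁ = x`, `zₙ = y` and `z_{k+1}` covers `z_k` for each `k`. -/
def IsPathList (y x : X) (l : List X) : Prop :=
  l ≠ [] ∧ l.head? = some x ∧ l.getLast? = some y ∧ l.Chain' (fun a b => CoversRel b a)

/-- `X` is a unique path space if for all `x, y` there is at most one path from `y` to `x`. -/
def UniquePathSpace (X : Type*) [TopologicalSpace X] : Prop :=
  ∀ x y : X, ∀ l₁ l₂ : List X, IsPathList y x l₁ → IsPathList y x l₂ → l₁ = l₂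

/-- The smallest open set containing a set `S` (in a finite space this is open). -/
def tildeSet (S : Set X) : Set X := ⋂₀ {U : Set X | IsOpen U ∧ S ⊆ U}

/-- The smallest open set containing the point `x`, denoted `õ{x}`. -/
def osi (x : X) : Set X := tildeSet {x}

/-- `S` is locally closed: `S = U \ V` for open sets `V ⊆ U`. -/
def LocClosed (S : Set X) : Prop :=
  ∃ U V : Set X, IsOpen U ∧ IsOpen V ∧ V ⊆ U ∧ S = U \ V

/-- `S` is relatively open in `T`. -/
def RelOpen (S T : Set X) : Prop := ∃ O : Set X, IsOpen O ∧ S = O ∩ T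

/-- `S` is relatively closed in `T`. -/
def RelClosed (S T : Set X) : Prop := ∃ Z : Set X, IsClosed Z ∧ S = Z ∩ T

/-- `(U, C)` is a boundary pair: `Y = U ∪ C` is locally closed, `U` is open in `Y`,
and `C = Y \ U`. -/
def BoundaryPair (U C : Set X) : Prop :=
  LocClosed (U ∪ C) ∧ RelOpen U (U ∪ C) ∧ C = (U ∪ C) \ U

/-- An elementary boundary pair. -/
def ElementaryBP (U C : Set X) : Prop :=
  BoundaryPair U C ∧ IsConnected U ∧ IsConnected C ∧ IsOpen U ∧ IsClosed C ∧
    U ⊆ tildeSet C ∧ C ⊆ closure U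

section UpperSetTopology

variable {α : Type*} [TopologicalSpace α] [PartialOrder α] [Topology.IsUpperSet α]

theorem specLE_iff_le {x y : α} : SpecLE x y ↔ x ≤ y := by
  simp [SpecLE, Topology.IsUpperSet.closure_singleton]

theorem specLT_iff_lt {x y : α} : SpecLT x y ↔ x < y := by
  simp [SpecLT, specLE_iff_le, lt_iff_le_not_ge]

theorem coversRel_iff_covBy {x y : α} : CoversRel y x ↔ x ⋖ y := by
  simp [CoversRel, specLT_iff_lt, CovBy]

theorem t0Space_of_isUpperSet : T0Space α :=
  ⟨fun _ _ h => le_antisymm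
    (specLE_iff_le.1 (h.symm.specializes.mem_closure))
    (specLE_iff_le.1 (h.specializes.mem_closure))⟩

theorem isConnected_Ici_of_isUpperSet (a : α) : IsConnected (Ici a) := by
  refine ⟨⟨a, le_rfl⟩, ?_⟩
  rintro u v hu hv hs ⟨x, hx, hxu⟩ ⟨y, hy, hyv⟩
  rw [Topology.IsUpperSet.isOpen_iff_isUpperSet] at hu hv
  rcases hs (mem_Ici.2 (le_refl a)) with ha | ha
  · exact ⟨y, hy, hu hy ha, hyv⟩
  · exact ⟨x, hx, hxu, hv hx ha⟩

theorem isConnected_Iic_of_isUpperSet (a : α) : IsConnected (Iic a) := by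
  rw [← Topology.IsUpperSet.closure_singleton]
  exact isConnected_singleton.closure

theorem IsPathList.le {x y : α} {l : List α} (h : IsPathList y x l) : x ≤ y := by
  induction l generalizing x with
  | nil => exact absurd rfl h.1
  | cons a t ih =>
    obtain ⟨-, hx, hy, hc⟩ := h
    obtain rfl : a = x := by simpa using hx
    cases t with
    | nil => exact (show a = y by simpa using hy).le
    | cons b t =>
      obtain ⟨hab, hc⟩ := List.isChain_cons_cons.1 hc
      exact (coversRel_iff_covBy.1 hab).le.trans
        (ih ⟨by simp, rfl, by simpa using hy, hc⟩)

/-- A poset with the upper set topology is a unique path space if its intervals are chains. -/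
theorem uniquePathSpace_of_total_Icc
    (H : ∀ x y a : α, x ≤ a → a ≤ y → ∀ b, x ≤ b → b ≤ y → a ≤ b ∨ b ≤ a) :
    UniquePathSpace α := by
  have tail {x y b : α} {t : List α} (h : IsPathList y x (x :: b :: t)) :
      x ⋖ b ∧ IsPathList y b (b :: t) := by
    obtain ⟨-, -, hy, hc⟩ := h
    obtain ⟨hab, hc⟩ := List.isChain_cons_cons.1 hc
    exact ⟨coversRel_iff_covBy.1 hab, by simp, rfl, by simpa using hy, hc⟩
  intro x y l
  induction l generalizing x with
  | nil => exact fun _ h => absurd rfl h.1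
  | cons a t ih =>
    rintro (- | ⟨b, s⟩) h₁ h₂
    · exact absurd rfl h₂.1
    obtain rfl : a = x := by simpa using h₁.2.1
    obtain rfl : b = a := by simpa using h₂.2.1
    rcases t with - | ⟨c, t⟩ <;> rcases s with - | ⟨d, s⟩
    · rfl
    · obtain rfl : b = y := by simpa using h₁.2.2.1
      exact absurd (tail h₂).2.le (tail h₂).1.lt.not_ge
    · obtain rfl : b = y := by simpa using h₂.2.2.1
      exact absurd (tail h₁).2.le (tail h₁).1.lt.not_ge
    · obtain ⟨hc, h₁⟩ := tail h₁
      obtain ⟨hd, h₂⟩ := tail h₂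
      obtain rfl : c = d := by
        rcases H b y c hc.le h₁.le d hd.le h₂.le with h | h
        · exact (hd.eq_or_eq hc.le h).resolve_left hc.lt.ne'
        · exact ((hc.eq_or_eq hd.le h).resolve_left hd.lt.ne').symm
      rw [ih c _ h₁ h₂]

end UpperSetTopology

/-- The points of a poset of height four. Its levels are `0, 1, 2`, then `3, 4, 5, 6`, then
`7, 8, 9, 10`, then `11, 12, 13`; the points `14` and `15` are isolated. -/
structure ZigzagPoset where
  /-- The index of a point. -/
  index : Fin 16
  deriving DecidableEq

namespace ZigzagPoset

/-- The indices of the points above a given one. The four points of the third level form a path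
whose edges are the points of the fourth level; those of the second level form the complementary
path, whose edges are the points of the first level. -/
def above : Fin 16 → List (Fin 16) :=
  ![[0, 4, 6, 8, 10, 11, 12, 13], [1, 3, 6, 7, 10, 11, 13], [2, 3, 5, 7, 9, 11, 12, 13],
    [3, 7, 11], [4, 8, 11, 12], [5, 9, 12, 13], [6, 10, 13],
    [7, 11], [8, 11, 12], [9, 12, 13], [10, 13], [11], [12], [13], [14], [15]]

instance : LE ZigzagPoset := ⟨fun x y => y.index ∈ above x.index⟩

instance : DecidableLE ZigzagPoset :=
  fun x y => inferInstanceAs (Decidable (y.index ∈ above x.index))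

/-- Points correspond to their indices. -/
def equivFin : ZigzagPoset ≃ Fin 16 := ⟨index, mk, fun _ => rfl, fun _ => rfl⟩

instance : Finite ZigzagPoset := Finite.of_equiv _ equivFin.symm

theorem forall_iff {p : ZigzagPoset → Prop} : (∀ x, p x) ↔ ∀ i, p ⟨i⟩ :=
  equivFin.symm.surjective.forall

instance {p : ZigzagPoset → Prop} [DecidablePred p] : Decidable (∀ x, p x) :=
  decidable_of_iff' _ forall_iff

instance : PartialOrder ZigzagPoset where
  le_refl := by decide +kernel
  le_trans := by
    have h : ∀ a b : ZigzagPoset, a ≤ b → ∀ c, b ≤ c → a ≤ c := by decide +kernel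
    exact fun a b c hab => h a b hab c
  le_antisymm := by decide +kernel

instance : TopologicalSpace ZigzagPoset := Topology.upperSet ZigzagPoset

instance : Topology.IsUpperSet ZigzagPoset := ⟨rfl⟩

/-- The union of the two upper levels. -/
def upperPart : Set ZigzagPoset := Ici ⟨7⟩ ∪ Ici ⟨8⟩ ∪ Ici ⟨9⟩ ∪ Ici ⟨10⟩

/-- The union of the two lower levels. -/
def lowerPart : Set ZigzagPoset := Iic ⟨5⟩ ∪ Iic ⟨3⟩ ∪ Iic ⟨6⟩ ∪ Iic ⟨4⟩

instance : DecidablePred (· ∈ upperPart) := fun x =>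
  inferInstanceAs (Decidable ((((⟨7⟩ ≤ x) ∨ ⟨8⟩ ≤ x) ∨ ⟨9⟩ ≤ x) ∨ ⟨10⟩ ≤ x))

instance : DecidablePred (· ∈ lowerPart) := fun x =>
  inferInstanceAs (Decidable ((((x ≤ ⟨5⟩) ∨ x ≤ ⟨3⟩) ∨ x ≤ ⟨6⟩) ∨ x ≤ ⟨4⟩))

theorem isOpen_upperPart : IsOpen upperPart := by
  rw [Topology.IsUpperSet.isOpen_iff_isUpperSet]
  exact (((isUpperSet_Ici _).union (isUpperSet_Ici _)).union (isUpperSet_Ici _)).union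
    (isUpperSet_Ici _)

theorem isClosed_lowerPart : IsClosed lowerPart := by
  rw [Topology.IsUpperSet.isClosed_iff_isLower]
  exact (((isLowerSet_Iic _).union (isLowerSet_Iic _)).union (isLowerSet_Iic _)).union
    (isLowerSet_Iic _)

theorem isConnected_upperPart : IsConnected upperPart := by
  refine (((isConnected_Ici_of_isUpperSet _).union ⟨⟨11⟩, ?_⟩
    (isConnected_Ici_of_isUpperSet _)).union ⟨⟨12⟩, ?_⟩
    (isConnected_Ici_of_isUpperSet _)).union ⟨⟨13⟩, ?_⟩ (isConnected_Ici_of_isUpperSet _) <;>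
  simp only [mem_inter_iff, mem_union, mem_Ici] <;> decide +kernel

theorem isConnected_lowerPart : IsConnected lowerPart := by
  refine (((isConnected_Iic_of_isUpperSet _).union ⟨⟨2⟩, ?_⟩
    (isConnected_Iic_of_isUpperSet _)).union ⟨⟨1⟩, ?_⟩
    (isConnected_Iic_of_isUpperSet _)).union ⟨⟨0⟩, ?_⟩ (isConnected_Iic_of_isUpperSet _) <;>
  simp only [mem_inter_iff, mem_union, mem_Iic] <;> decide +kernel

theorem disjoint_lowerPart_upperPart : Disjoint lowerPart upperPart := by
  have h : ∀ x, x ∈ lowerPart → x ∉ upperPart := by decide +kernel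
  exact Set.disjoint_left.2 h

theorem upperPart_union_lowerPart : upperPart ∪ lowerPart = ({⟨14⟩, ⟨15⟩} : Set ZigzagPoset)ᶜ := by
  have h : ∀ x, x ∈ upperPart ∨ x ∈ lowerPart ↔ ¬ (x = ⟨14⟩ ∨ x = ⟨15⟩) := by decide +kernel
  exact Set.ext h

theorem isOpen_upperPart_union_lowerPart : IsOpen (upperPart ∪ lowerPart) := by
  have h : ∀ x y : ZigzagPoset, x ≤ y → ¬ (x = ⟨14⟩ ∨ x = ⟨15⟩) → ¬ (y = ⟨14⟩ ∨ y = ⟨15⟩) := by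
    decide +kernel
  rw [Topology.IsUpperSet.isOpen_iff_isUpperSet, upperPart_union_lowerPart]
  exact h

theorem elementaryBP : ElementaryBP upperPart lowerPart := by
  refine ⟨⟨⟨_, ∅, isOpen_upperPart_union_lowerPart, isOpen_empty, empty_subset _, by simp⟩,
    ⟨upperPart, isOpen_upperPart, by simp⟩, ?_⟩, isConnected_upperPart, isConnected_lowerPart,
    isOpen_upperPart, isClosed_lowerPart, ?_, ?_⟩
  · rw [union_sdiff_left, disjoint_lowerPart_upperPart.sdiff_eq_left]
  · have h : ∀ x, x ∈ upperPart → ¬ ∀ y, y ∈ lowerPart → ¬ y ≤ x := by decide +kernel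
    rintro x hx O ⟨hO, hCO⟩
    have := h x hx
    push Not at this
    obtain ⟨y, hy, hyx⟩ := this
    rw [Topology.IsUpperSet.isOpen_iff_isUpperSet] at hO
    exact hO hyx (hCO hy)
  · have h : ∀ x, x ∈ lowerPart → ¬ ∀ y, y ∈ upperPart → ¬ x ≤ y := by decide +kernel
    intro x hx
    have := h x hx
    push Not at this
    obtain ⟨y, hy, hxy⟩ := this
    exact closure_mono (singleton_subset_iff.2 hy) (specLE_iff_le.2 hxy)

theorem lowerPart_ne_closure_singleton (y : ZigzagPoset) : lowerPart ≠ closure {y} := by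
  have h : ∀ y : ZigzagPoset, ¬ ∀ x, x ∈ lowerPart ↔ x ≤ y := by decide +kernel
  rw [Topology.IsUpperSet.closure_singleton]
  exact fun e => h y (Set.ext_iff.1 e)

theorem uniquePathSpace : UniquePathSpace ZigzagPoset :=
  uniquePathSpace_of_total_Icc (by decide +kernel)

end ZigzagPoset

theorem stmt_8 :
    ∃ (X : Type) (_ : TopologicalSpace X) (_ : Finite X) (_ : T0Space X),
      Nat.card X = 16 ∧ UniquePathSpace X ∧
        ∃ U C : Set X, ElementaryBP U C ∧
          ¬ ∃ x y : X, CoversRel x y ∧ U = osi x ∧ C = closure ({y} : Set X) := by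
  refine ⟨ZigzagPoset, inferInstance, inferInstance, t0Space_of_isUpperSet,
    by simp [Nat.card_congr ZigzagPoset.equivFin], ZigzagPoset.uniquePathSpace, _, _,
    ZigzagPoset.elementaryBP, ?_⟩
  rintro ⟨-, y, -, -, h⟩
  exact ZigzagPoset.lowerPart_ne_closure_singleton y h
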